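/- arXiv:1612.07866 — 3 statements merged into one kernel-verified Lean document; each statement's English description precedes it below -/
import Mathlib

section
/- Let $\bm{T}\in(\mathbb{R}^d)^{\otimes k}$ be a symmetric tensor, take $a=\lfloor k/2\rfloor$, $b = \lceil k/2\rceil$, and let $X = \mathrm{unfold}^{a\times b}(\bm{T})$. Let $B$ be a positive semidefinite $d^a\times d^a$ matrix, $\lambda_\star > \|B-XX^{\mathsf{t}}\|_{\mathrm{op}}$, $Q$ the orthogonal projection onto the eigenspace of $B$ with eigenvalues $\ge\lambda_\star$, and $\mathcal{Q}$ equal to $Q\otimes Q\otimes Q$ if $k=3$, $Q\otimes Q$ if $k\ge4$ even, and $Q\otimes Q\otimes I_d$ if $k\ge5$ odd. Then $\bm{T}^\star = \mathcal{Q}(\bm{T})$ satisfies $\|\bm{T} - \bm{T}^\star\|_F \le 3(\mathrm{rank}\,X)^{1/2}\Big((2\lambda_\star)^{1/2} + \frac{\|B - XX^{\mathsf{t}}\|_{\mathrm{op}}\,\|X\|_{\mathrm{op}}}{\lambda_\star}\Big)$. -/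
open Matrix

/-- The spectral (operator) norm of a real matrix. -/
noncomputable def opNorm {m n : Type*} [Fintype m] [Fintype n] [DecidableEq n]
    (M : Matrix m n ℝ) : ℝ :=
  ‖LinearMap.toContinuousLinearMap (Matrix.toEuclideanLin M)‖

/-- Frobenius (euclidean) norm of a tensor given as a multi-indexed array. -/
noncomputable def tfrob {ι : Type*} [Fintype ι] (T : ι → ℝ) : ℝ :=
  Real.sqrt (∑ u, (T u) ^ 2)

/-- The `a × (k-a)` unfolding of a tensor `T ∈ (ℝ^d)^{⊗k}`. -/
def unfoldT (d k a : ℕ) (T : (Fin k → Fin d) → ℝ) :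
    Matrix (Fin a → Fin d) (Fin (k - a) → Fin d) ℝ :=
  Matrix.of fun i ℓ =>
    T fun j => if h : j.1 < a then i ⟨j.1, h⟩
      else ℓ ⟨j.1 - a, by have := j.2; omega⟩

/-- The segment of a multi-index `u : Fin k → Fin d` starting at `off` with length `len`. -/
def seg (d : ℕ) {k : ℕ} (off len : ℕ) (h : off + len ≤ k)
    (u : Fin k → Fin d) : Fin len → Fin d :=
  fun j => u ⟨off + j.1, by have := j.2; omega⟩

/-- A tensor is symmetric if it is invariant under permutations of its indices. -/
def SymTensor (d k : ℕ) (T : (Fin k → Fin d) → ℝ) : Prop :=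
  ∀ (σ : Equiv.Perm (Fin k)) (u : Fin k → Fin d), T (u ∘ σ) = T u

/-- `Q` is the orthogonal projection onto the span of the eigenvectors of `B`
with eigenvalues `≥ lam`. -/
def IsSpectralProj {n : Type*} [Fintype n] [DecidableEq n]
    (B : Matrix n n ℝ) (lam : ℝ) (Q : Matrix n n ℝ) : Prop :=
  Qᵀ = Q ∧ Q * Q = Q ∧
    LinearMap.range Q.mulVecLin =
      Submodule.span ℝ {v : n → ℝ | ∃ μ : ℝ, lam ≤ μ ∧ B.mulVec v = μ • v}

open scoped Kronecker

section SpectralProjection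

variable {n m : Type*} [Fintype n] [DecidableEq n] [Fintype m]

theorem abs_dotProduct_mulVec_le_opNorm (E : Matrix n n ℝ) (y : n → ℝ) :
    |y ⬝ᵥ E *ᵥ y| ≤ opNorm E * (y ⬝ᵥ y) := by
  set z : EuclideanSpace ℝ n := WithLp.toLp 2 y with hz
  set L := LinearMap.toContinuousLinearMap (Matrix.toEuclideanLin E) with hL
  have h1 : y ⬝ᵥ E *ᵥ y = inner ℝ (L z) z := by
    rw [hL, LinearMap.coe_toContinuousLinearMap', hz, Matrix.toLpLin_toLp,
      EuclideanSpace.inner_toLp_toLp]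
    simp
  have h2 : y ⬝ᵥ y = ‖z‖ * ‖z‖ := by
    rw [← real_inner_self_eq_norm_mul_norm, hz, EuclideanSpace.inner_toLp_toLp]
    simp
  rw [h1, h2, ← mul_assoc]
  exact (abs_real_inner_le_norm _ _).trans
    (mul_le_mul_of_nonneg_right (L.le_opNorm z) (norm_nonneg z))

theorem IsSpectralProj.dotProduct_mulVec_le {B Q : Matrix n n ℝ} {lam : ℝ}
    (hQ : IsSpectralProj B lam Q) (hB : B.IsHermitian) {y : n → ℝ} (hy : Q *ᵥ y = 0) :
    y ⬝ᵥ B *ᵥ y ≤ lam * (y ⬝ᵥ y) := by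
  obtain ⟨hsymm, -, hrange⟩ := hQ
  set b := hB.eigenvectorBasis
  set z : EuclideanSpace ℝ n := WithLp.toLp 2 y with hz
  have hyy : y ⬝ᵥ y = ∑ i, inner ℝ z (b i) * inner ℝ (b i) z := by
    rw [b.sum_inner_mul_inner, hz, EuclideanSpace.inner_toLp_toLp]
    simp
  have hcoord (i : n) : inner ℝ (b i) z = (b i).ofLp ⬝ᵥ y := by
    rw [dotProduct_comm]
    exact EuclideanSpace.inner_toLp_toLp (b i).ofLp y
  have hBi (i : n) : inner ℝ (b i) (WithLp.toLp 2 (B *ᵥ y)) =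
      hB.eigenvalues i * inner ℝ (b i) z := by
    have h : inner ℝ (b i) (WithLp.toLp 2 (B *ᵥ y)) = (b i).ofLp ⬝ᵥ (B *ᵥ y) := by
      rw [dotProduct_comm]
      exact EuclideanSpace.inner_toLp_toLp (b i).ofLp (B *ᵥ y)
    have hBt : Bᵀ = B := by simpa using hB.eq
    rw [h, dotProduct_mulVec, ← mulVec_transpose, hBt, hB.mulVec_eigenvectorBasis i,
      smul_dotProduct, hcoord, smul_eq_mul]
  have hyBy : y ⬝ᵥ B *ᵥ y =
      ∑ i, inner ℝ z (b i) * (hB.eigenvalues i * inner ℝ (b i) z) := by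
    simp_rw [← hBi]
    rw [b.sum_inner_mul_inner, hz, EuclideanSpace.inner_toLp_toLp, dotProduct_comm]
    simp
  rw [hyBy, hyy, Finset.mul_sum]
  refine Finset.sum_le_sum fun i _ => ?_
  rw [real_inner_comm]
  rcases lt_or_ge (hB.eigenvalues i) lam with hi | hi
  · nlinarith [mul_self_nonneg (inner ℝ (b i) z)]
  · have hmem : (b i).ofLp ∈ LinearMap.range Q.mulVecLin := by
      rw [hrange]
      exact Submodule.subset_span ⟨_, hi, hB.mulVec_eigenvectorBasis i⟩
    obtain ⟨w, hw⟩ := hmem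
    have h0 : inner ℝ (b i) z = 0 := by
      rw [hcoord, ← hw, mulVecLin_apply, ← vecMul_transpose, hsymm, ← dotProduct_mulVec, hy,
        dotProduct_zero]
    simp [h0]

theorem trace_le_rank_mul {M : Matrix n n ℝ} (hM : M.IsHermitian) {c : ℝ}
    (h : ∀ x, x ⬝ᵥ M *ᵥ x ≤ c * (x ⬝ᵥ x)) : M.trace ≤ M.rank * c := by
  rw [hM.trace_eq_sum_eigenvalues, hM.rank_eq_card_non_zero_eigs, Fintype.card_subtype,
    ← nsmul_eq_mul, ← Finset.sum_const, Finset.sum_filter]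
  refine Finset.sum_le_sum fun i _ => ?_
  split_ifs with hi
  · have hv : (hM.eigenvectorBasis i).ofLp ⬝ᵥ (hM.eigenvectorBasis i).ofLp = 1 := by
      have h1 := hM.eigenvectorBasis.orthonormal.1 i
      have h2 := real_inner_self_eq_norm_mul_norm (hM.eigenvectorBasis i)
      rw [h1, one_mul] at h2
      exact h2
    have := h (hM.eigenvectorBasis i).ofLp
    rw [hM.mulVec_eigenvectorBasis, dotProduct_smul, hv] at this
    simpa using this
  · simp [not_not.mp hi]

theorem IsSpectralProj.sum_sq_sub_mul_le {B Q : Matrix n n ℝ} {lam : ℝ}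
    (hQ : IsSpectralProj B lam Q) (hB : B.IsHermitian) (X : Matrix n m ℝ)
    (hlam : opNorm (B - X * Xᵀ) ≤ lam) :
    ∑ l, ∑ i, ((X - Q * X) i l) ^ 2 ≤ X.rank * (2 * lam) := by
  have hlam0 : 0 ≤ lam := (norm_nonneg _).trans hlam
  set P : Matrix n n ℝ := 1 - Q with hP
  have hPX : X - Q * X = P * X := by rw [hP, Matrix.sub_mul, Matrix.one_mul]
  have hPt : Pᵀ = P := by rw [hP, transpose_sub, transpose_one, hQ.1]
  have hQP : Q * P = 0 := by rw [hP, mul_sub, mul_one, hQ.2.1, sub_self]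
  have hM : (P * X * (P * X)ᵀ).IsHermitian := by
    simpa using isHermitian_mul_conjTranspose_self (P * X)
  have htrace : ∑ l, ∑ i, ((X - Q * X) i l) ^ 2 = (P * X * (P * X)ᵀ).trace := by
    rw [hPX, Finset.sum_comm]
    simp only [trace, diag_apply, mul_apply (M := P * X), transpose_apply, sq]
  have hrank : (P * X * (P * X)ᵀ).rank ≤ X.rank :=
    (rank_mul_le_left _ _).trans (rank_mul_le_right _ _)
  rw [htrace]
  refine (trace_le_rank_mul hM (c := 2 * lam) fun x => ?_).trans ?_
  · set y := P *ᵥ x with hy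
    have hQy : Q *ᵥ y = 0 := by rw [hy, mulVec_mulVec, hQP, zero_mulVec]
    have hquad : x ⬝ᵥ (P * X * (P * X)ᵀ) *ᵥ x = y ⬝ᵥ (X * Xᵀ) *ᵥ y := by
      rw [transpose_mul, hPt, Matrix.mul_assoc, ← mulVec_mulVec, dotProduct_mulVec,
        ← mulVec_transpose, hPt, hy, mulVec_mulVec, Matrix.mul_assoc]
    have hyx : y ⬝ᵥ y ≤ x ⬝ᵥ x := by
      have hx : x = y + Q *ᵥ x := by rw [hy, ← add_mulVec, hP, sub_add_cancel, one_mulVec]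
      have horth : y ⬝ᵥ Q *ᵥ x = 0 := by
        rw [dotProduct_mulVec, ← mulVec_transpose, hQ.1, hQy, zero_dotProduct]
      have hnn : 0 ≤ (Q *ᵥ x) ⬝ᵥ (Q *ᵥ x) := dotProduct_self_star_nonneg (Q *ᵥ x)
      calc y ⬝ᵥ y ≤ (y + Q *ᵥ x) ⬝ᵥ (y + Q *ᵥ x) := by
            rw [add_dotProduct, dotProduct_add, dotProduct_add, dotProduct_comm (Q *ᵥ x) y, horth]
            linarith
        _ = x ⬝ᵥ x := by rw [← hx]
    have hyy : 0 ≤ y ⬝ᵥ y := dotProduct_self_star_nonneg y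
    have h1 := hQ.dotProduct_mulVec_le hB hQy
    have h2 := (abs_le.mp (abs_dotProduct_mulVec_le_opNorm (B - X * Xᵀ) y)).1
    rw [sub_mulVec, dotProduct_sub] at h2
    rw [hquad]
    nlinarith [mul_le_mul_of_nonneg_right hlam hyy, mul_le_mul_of_nonneg_left hyx hlam0]
  · gcongr

end SpectralProjection

section Frobenius

variable {ι κ : Type*} [Fintype ι] [Fintype κ]

theorem tfrob_eq_norm (f : ι → ℝ) : tfrob f = ‖WithLp.toLp 2 f‖ := by
  simp [tfrob, EuclideanSpace.norm_eq]

theorem tfrob_add_le (f g : ι → ℝ) : tfrob (f + g) ≤ tfrob f + tfrob g := by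
  simp only [tfrob_eq_norm, WithLp.toLp_add]
  exact norm_add_le _ _

theorem tfrob_comp_equiv (e : ι ≃ κ) (f : κ → ℝ) : tfrob (f ∘ e) = tfrob f := by
  simp only [tfrob, Function.comp_apply]
  rw [e.sum_comp fun u => f u ^ 2]

theorem tfrob_mulVec_le {N : Matrix ι ι ℝ} (hN : IsHermitian N) (hN2 : IsIdempotentElem N)
    (f : ι → ℝ) : tfrob (N *ᵥ f) ≤ tfrob f := by
  have hNt : Nᵀ = N := by simpa using hN.eq
  refine Real.sqrt_le_sqrt ?_
  have hdot (g : ι → ℝ) : ∑ u, g u ^ 2 = g ⬝ᵥ g := by simp [dotProduct, sq]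
  have h1 : (N *ᵥ f) ⬝ᵥ (N *ᵥ f) = f ⬝ᵥ (N *ᵥ f) := by
    rw [dotProduct_mulVec, ← mulVec_transpose, hNt, mulVec_mulVec, hN2.eq, dotProduct_comm]
  have h2 : 0 ≤ (f - N *ᵥ f) ⬝ᵥ (f - N *ᵥ f) := dotProduct_self_star_nonneg _
  rw [sub_dotProduct, dotProduct_sub, dotProduct_sub, dotProduct_comm (N *ᵥ f) f, h1] at h2
  rw [hdot, hdot, h1]
  linarith

end Frobenius

section ThreeFactors

variable {A C : Type*} [Fintype A] [Fintype C] [DecidableEq A] [DecidableEq C]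

theorem tfrob_sub_kronecker_mulVec_le {Q : Matrix A A ℝ} (hQ : Q.IsHermitian)
    (hQ2 : IsIdempotentElem Q) (R : Matrix C C ℝ) {S : A × A × C → ℝ}
    (hS : ∀ a b c, S (b, a, c) = S (a, b, c)) :
    tfrob (S - (Q ⊗ₖ (Q ⊗ₖ R)) *ᵥ S) ≤
      2 * tfrob (S - (Q ⊗ₖ (1 : Matrix (A × C) (A × C) ℝ)) *ᵥ S) +
        tfrob (S - ((1 : Matrix A A ℝ) ⊗ₖ ((1 : Matrix A A ℝ) ⊗ₖ R)) *ᵥ S) := by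
  set N₁ : Matrix (A × A × C) (A × A × C) ℝ := Q ⊗ₖ (1 : Matrix (A × C) (A × C) ℝ) with h₁
  set N₂ : Matrix (A × A × C) (A × A × C) ℝ :=
    (1 : Matrix A A ℝ) ⊗ₖ (Q ⊗ₖ (1 : Matrix C C ℝ)) with h₂
  set N₃ : Matrix (A × A × C) (A × A × C) ℝ :=
    (1 : Matrix A A ℝ) ⊗ₖ ((1 : Matrix A A ℝ) ⊗ₖ R) with h₃
  have hprod : Q ⊗ₖ (Q ⊗ₖ R) = N₁ * (N₂ * N₃) := by
    simp [h₁, h₂, h₃, ← mul_kronecker_mul]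
  have hN₁ : N₁.IsHermitian := by
    rw [IsHermitian, h₁, conjTranspose_kronecker, hQ.eq, conjTranspose_one]
  have hN₁' : IsIdempotentElem N₁ := by
    rw [IsIdempotentElem, h₁, ← mul_kronecker_mul, hQ2.eq, one_mul]
  have hN₂ : N₂.IsHermitian := by
    rw [IsHermitian, h₂, conjTranspose_kronecker, conjTranspose_kronecker, hQ.eq,
      conjTranspose_one, conjTranspose_one]
  have hN₂' : IsIdempotentElem N₂ := by
    rw [IsIdempotentElem, h₂, ← mul_kronecker_mul, ← mul_kronecker_mul, hQ2.eq, one_mul, one_mul]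
  let e : A × A × C ≃ A × A × C :=
    ⟨fun p => (p.2.1, p.1, p.2.2), fun p => (p.2.1, p.1, p.2.2), fun _ => rfl, fun _ => rfl⟩
  have hswap : tfrob (S - N₂ *ᵥ S) = tfrob (S - N₁ *ᵥ S) := by
    rw [← tfrob_comp_equiv e (S - N₁ *ᵥ S)]
    congr 1
    ext ⟨a, b, c⟩
    simp [e, h₁, h₂, mulVec, dotProduct, Fintype.sum_prod_type, one_apply, hS,
      kroneckerMap_apply, Prod.ext_iff, ite_and]
  have hsplit : S - (Q ⊗ₖ (Q ⊗ₖ R)) *ᵥ S =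
      (S - N₁ *ᵥ S) + (N₁ *ᵥ (S - N₂ *ᵥ S) + N₁ *ᵥ (N₂ *ᵥ (S - N₃ *ᵥ S))) := by
    simp only [hprod, mulVec_sub, mulVec_mulVec]
    abel
  rw [hsplit]
  linarith [tfrob_add_le (S - N₁ *ᵥ S)
      (N₁ *ᵥ (S - N₂ *ᵥ S) + N₁ *ᵥ (N₂ *ᵥ (S - N₃ *ᵥ S))),
    tfrob_add_le (N₁ *ᵥ (S - N₂ *ᵥ S)) (N₁ *ᵥ (N₂ *ᵥ (S - N₃ *ᵥ S))),
    tfrob_mulVec_le hN₁ hN₁' (S - N₂ *ᵥ S),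
    tfrob_mulVec_le hN₁ hN₁' (N₂ *ᵥ (S - N₃ *ᵥ S)),
    tfrob_mulVec_le hN₂ hN₂' (S - N₃ *ᵥ S)]

theorem tfrob_sub_third_factor_eq (Q : Matrix A A ℝ) {S : A × A × A → ℝ}
    (hS : ∀ a b c, S (c, b, a) = S (a, b, c)) :
    tfrob (S - ((1 : Matrix A A ℝ) ⊗ₖ ((1 : Matrix A A ℝ) ⊗ₖ Q)) *ᵥ S) =
      tfrob (S - (Q ⊗ₖ (1 : Matrix (A × A) (A × A) ℝ)) *ᵥ S) := by
  let e : A × A × A ≃ A × A × A :=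
    ⟨fun p => (p.2.2, p.2.1, p.1), fun p => (p.2.2, p.2.1, p.1), fun _ => rfl, fun _ => rfl⟩
  rw [← tfrob_comp_equiv e]
  congr 1
  ext ⟨a, b, c⟩
  simp [e, mulVec, dotProduct, Fintype.sum_prod_type, one_apply, hS,
      kroneckerMap_apply, Prod.ext_iff, ite_and]

theorem tfrob_sub_first_factor {ι κ : Type*} [Fintype ι] [Fintype κ] [DecidableEq κ]
    (Q : Matrix ι ι ℝ) (S : ι × κ → ℝ) :
    tfrob (S - (Q ⊗ₖ (1 : Matrix κ κ ℝ)) *ᵥ S) =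
      √(∑ l, ∑ i, ((of fun i l => S (i, l)) - Q * of fun i l => S (i, l)) i l ^ 2) := by
  rw [tfrob, Fintype.sum_prod_type_right]
  simp [mulVec, dotProduct, Fintype.sum_prod_type, one_apply, kroneckerMap_apply, mul_apply]

end ThreeFactors

section Tensor

variable {d k a n : ℕ}

theorem SymTensor.comp_involutive {T : (Fin k → Fin d) → ℝ} (hT : SymTensor d k T)
    {f : Fin k → Fin k} (hf : Function.Involutive f) (u : Fin k → Fin d) : T (u ∘ f) = T u :=
  hT hf.toPerm u

/-- Splitting a multi-index into two blocks. -/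
def twoBlocks (d : ℕ) {m : ℕ} (h : a + n = m) :
    (Fin a → Fin d) × (Fin n → Fin d) ≃ (Fin m → Fin d) where
  toFun p j := if hj : j.1 < a then p.1 ⟨j.1, hj⟩ else p.2 ⟨j.1 - a, by have := j.2; omega⟩
  invFun u := (seg d 0 a (by omega) u, seg d a n (by omega) u)
  left_inv p := by
    ext j <;> simp [seg]
  right_inv u := by
    ext j
    by_cases hj : j.1 < a
    · simp [seg, hj]
    · simp [seg, hj, Nat.add_sub_cancel' (not_lt.mp hj)]

/-- Splitting a multi-index into two blocks of length `a` and a block of length `n`. -/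
def threeBlocks (d : ℕ) (h : 2 * a + n = k) :
    (Fin a → Fin d) × (Fin a → Fin d) × (Fin n → Fin d) ≃ (Fin k → Fin d) where
  toFun p j := if hj : j.1 < a then p.1 ⟨j.1, hj⟩
    else if hj' : j.1 < 2 * a then p.2.1 ⟨j.1 - a, by omega⟩
    else p.2.2 ⟨j.1 - 2 * a, by have := j.2; omega⟩
  invFun u := (seg d 0 a (by omega) u, seg d a a (by omega) u, seg d (2 * a) n (by omega) u)
  left_inv p := by
    ext j
    · simp [seg]
    · have := j.2
      have h1 : a + j.1 < 2 * a := by omega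
      simp [seg, h1]
    · have h1 : ¬ 2 * a + j.1 < a := by omega
      simp [seg, h1]
  right_inv u := by
    ext j
    by_cases hj : j.1 < a
    · simp [seg, hj]
    · by_cases hj' : j.1 < 2 * a
      · simp [seg, hj, hj', Nat.add_sub_cancel' (not_lt.mp hj)]
      · simp [seg, hj, hj', Nat.add_sub_cancel' (not_lt.mp hj')]

theorem SymTensor.threeBlocks_swap_first_second {T : (Fin k → Fin d) → ℝ} (hT : SymTensor d k T)
    (h : 2 * a + n = k) (x y : Fin a → Fin d) (z : Fin n → Fin d) :
    T (threeBlocks d h (y, x, z)) = T (threeBlocks d h (x, y, z)) := by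
  let f : Fin k → Fin k := fun j =>
    if hj : j.1 < a then ⟨j.1 + a, by omega⟩
    else if hj' : j.1 < 2 * a then ⟨j.1 - a, by omega⟩ else j
  have hf : Function.Involutive f := by
    intro j
    by_cases hj : j.1 < a
    · have h1 : j.1 + a < 2 * a := by omega
      simp [f, hj, h1]
    · by_cases hj' : j.1 < 2 * a
      · have h1 : j.1 - a < a := by omega
        simp [f, hj, hj', h1, Nat.sub_add_cancel (not_lt.mp hj)]
      · simp [f, hj, hj']
  rw [← hT.comp_involutive hf (threeBlocks d h (x, y, z))]
  congr 1
  ext j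
  by_cases hj : j.1 < a
  · have h1 : j.1 + a < 2 * a := by omega
    simp [threeBlocks, f, hj, h1]
  · by_cases hj' : j.1 < 2 * a
    · have h1 : j.1 - a < a := by omega
      simp [threeBlocks, f, hj, hj', h1]
    · simp [threeBlocks, f, hj, hj']

theorem SymTensor.threeBlocks_swap_first_third {T : (Fin k → Fin d) → ℝ} (hT : SymTensor d k T)
    (h : 2 * a + a = k) (x y z : Fin a → Fin d) :
    T (threeBlocks d h (z, y, x)) = T (threeBlocks d h (x, y, z)) := by
  let f : Fin k → Fin k := fun j =>
    if hj : j.1 < a then ⟨j.1 + 2 * a, by omega⟩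
    else if hj' : j.1 < 2 * a then j else ⟨j.1 - 2 * a, by omega⟩
  have hf : Function.Involutive f := by
    intro j
    have := j.2
    by_cases hj : j.1 < a
    · have h1 : ¬ j.1 + 2 * a < a := by omega
      simp [f, hj, h1]
    · by_cases hj' : j.1 < 2 * a
      · simp [f, hj, hj']
      · have h1 : j.1 - 2 * a < a := by omega
        simp [f, hj, hj', h1, Nat.sub_add_cancel (not_lt.mp hj')]
  rw [← hT.comp_involutive hf (threeBlocks d h (x, y, z))]
  congr 1
  ext j
  have hjk := j.2
  by_cases hj : j.1 < a
  · have h1 : ¬ j.1 + 2 * a < a := by omega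
    simp [threeBlocks, f, hj, h1]
  · by_cases hj' : j.1 < 2 * a
    · simp [threeBlocks, f, hj, hj']
    · have h1 : j.1 - 2 * a < a := by omega
      simp [threeBlocks, f, hj, hj', h1]

theorem unfoldT_twoBlocks (T : (Fin k → Fin d) → ℝ) (h : 2 * a + n = k) (h' : a + n = k - a)
    (x : Fin a → Fin d) (p : (Fin a → Fin d) × (Fin n → Fin d)) :
    unfoldT d k a T x (twoBlocks d h' p) = T (threeBlocks d h (x, p)) := by
  rw [unfoldT, of_apply]
  congr 1
  ext j
  by_cases hj : j.1 < a
  · simp [threeBlocks, hj]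
  · by_cases hj' : j.1 < 2 * a
    · have h1 : j.1 - a < a := by omega
      simp [threeBlocks, twoBlocks, hj, hj', h1]
    · have h1 : ¬ j.1 - a < a := by omega
      have h2 : j.1 - a - a = j.1 - 2 * a := by omega
      simp [threeBlocks, twoBlocks, hj, hj', h1, h2]

theorem tfrob_threeBlocks_sub_first_factor (T : (Fin k → Fin d) → ℝ) (h : 2 * a + n = k)
    (Q : Matrix (Fin a → Fin d) (Fin a → Fin d) ℝ) :
    tfrob (T ∘ threeBlocks d h - (Q ⊗ₖ (1 : Matrix ((Fin a → Fin d) × (Fin n → Fin d))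
        ((Fin a → Fin d) × (Fin n → Fin d)) ℝ)) *ᵥ (T ∘ threeBlocks d h)) =
      √(∑ l, ∑ i, (unfoldT d k a T - Q * unfoldT d k a T) i l ^ 2) := by
  have h' : a + n = k - a := by omega
  have hsub : (of fun i l => (T ∘ threeBlocks d h) (i, l)) =
      (unfoldT d k a T).submatrix id (twoBlocks d h') := by
    ext i p
    exact (unfoldT_twoBlocks T h h' i p).symm
  rw [tfrob_sub_first_factor, hsub, ← (twoBlocks d h').sum_comp]
  rfl

theorem tfrob_sub_sum_seg_eq (T : (Fin k → Fin d) → ℝ) (h : 2 * a + n = k)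
    (Q : Matrix (Fin a → Fin d) (Fin a → Fin d) ℝ)
    (R : Matrix (Fin n → Fin d) (Fin n → Fin d) ℝ) :
    tfrob (fun u : Fin k → Fin d => T u - ∑ v : Fin k → Fin d,
        Q (seg d 0 a (by omega) u) (seg d 0 a (by omega) v) *
        Q (seg d a a (by omega) u) (seg d a a (by omega) v) *
        R (seg d (2 * a) n (by omega) u) (seg d (2 * a) n (by omega) v) * T v) =
      tfrob (T ∘ threeBlocks d h - (Q ⊗ₖ (Q ⊗ₖ R)) *ᵥ (T ∘ threeBlocks d h)) := by
  rw [← tfrob_comp_equiv (threeBlocks d h).symm]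
  congr 1
  ext u
  simp only [Function.comp_apply, Pi.sub_apply, Equiv.apply_symm_apply, mulVec, dotProduct]
  rw [← (threeBlocks d h).symm.sum_comp]
  simp only [Equiv.apply_symm_apply, kroneckerMap_apply, mul_assoc]
  rfl

end Tensor

/-- For a symmetric tensor `T ∈ (ℝ^d)^{⊗k}`, `a = ⌊k/2⌋`, `X = unfold^{a×b}(T)`,
`B` psd with `λ⋆ > ‖B - XXᵀ‖_op`, `Q` the spectral projection of `B` at level `λ⋆`,
and `𝒬 = Q⊗Q⊗Q` (`k=3`), `Q⊗Q` (`k` even), `Q⊗Q⊗I_d` (`k ≥ 5` odd), the tensor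
`T⋆ = 𝒬(T)` satisfies
`‖T - T⋆‖_F ≤ 3 (rank X)^{1/2} ((2λ⋆)^{1/2} + ‖B - XXᵀ‖_op ‖X‖_op / λ⋆)`. -/
theorem stmt14 {d k : ℕ} (hk : 3 ≤ k)
    (T : (Fin k → Fin d) → ℝ) (hsym : SymTensor d k T)
    (B : Matrix (Fin (k / 2) → Fin d) (Fin (k / 2) → Fin d) ℝ) (hB : B.PosSemidef)
    (lam : ℝ) (Q : Matrix (Fin (k / 2) → Fin d) (Fin (k / 2) → Fin d) ℝ)
    (hQ : IsSpectralProj B lam Q)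
    (X : Matrix (Fin (k / 2) → Fin d) (Fin (k - k / 2) → Fin d) ℝ)
    (hX : X = unfoldT d k (k / 2) T)
    (hlam : opNorm (B - X * Xᵀ) < lam) :
    (∀ _hk3 : k = 3,
      tfrob (fun u : Fin k → Fin d => T u - ∑ v : Fin k → Fin d,
          Q (seg d 0 (k / 2) (by omega) u) (seg d 0 (k / 2) (by omega) v) *
          Q (seg d (k / 2) (k / 2) (by omega) u) (seg d (k / 2) (k / 2) (by omega) v) *
          Q (seg d (2 * (k / 2)) (k / 2) (by omega) u)
            (seg d (2 * (k / 2)) (k / 2) (by omega) v) * T v) ≤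
        3 * Real.sqrt (X.rank) *
          (Real.sqrt (2 * lam) + opNorm (B - X * Xᵀ) * opNorm X / lam)) ∧
    (∀ _hke : k % 2 = 0,
      tfrob (fun u : Fin k → Fin d => T u - ∑ v : Fin k → Fin d,
          Q (seg d 0 (k / 2) (by omega) u) (seg d 0 (k / 2) (by omega) v) *
          Q (seg d (k / 2) (k / 2) (by omega) u) (seg d (k / 2) (k / 2) (by omega) v) *
          T v) ≤
        3 * Real.sqrt (X.rank) *
          (Real.sqrt (2 * lam) + opNorm (B - X * Xᵀ) * opNorm X / lam)) ∧
    (∀ _hko : 5 ≤ k ∧ k % 2 = 1,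
      tfrob (fun u : Fin k → Fin d => T u - ∑ v : Fin k → Fin d,
          Q (seg d 0 (k / 2) (by omega) u) (seg d 0 (k / 2) (by omega) v) *
          Q (seg d (k / 2) (k / 2) (by omega) u) (seg d (k / 2) (k / 2) (by omega) v) *
          (if seg d (2 * (k / 2)) (k - 2 * (k / 2)) (by omega) u =
              seg d (2 * (k / 2)) (k - 2 * (k / 2)) (by omega) v then (1 : ℝ) else 0) *
          T v) ≤
        3 * Real.sqrt (X.rank) *
          (Real.sqrt (2 * lam) + opNorm (B - X * Xᵀ) * opNorm X / lam)) := by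
  subst hX
  have hlam0 : 0 ≤ opNorm (B - unfoldT d k (k / 2) T * (unfoldT d k (k / 2) T)ᵀ) := norm_nonneg _
  have hQh : Q.IsHermitian := by
    rw [IsHermitian, conjTranspose_eq_transpose_of_trivial]
    exact hQ.1
  set X := unfoldT d k (k / 2) T with hX
  have hfirst : √(∑ l, ∑ i, (X - Q * X) i l ^ 2) ≤ √X.rank * √(2 * lam) := by
    rw [← Real.sqrt_mul (Nat.cast_nonneg _)]
    exact Real.sqrt_le_sqrt (hQ.sum_sq_sub_mul_le hB.1 X hlam.le)
  have herr : 0 ≤ √X.rank * (opNorm (B - X * Xᵀ) * opNorm X / lam) :=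
    mul_nonneg (Real.sqrt_nonneg _)
      (div_nonneg (mul_nonneg hlam0 (norm_nonneg _)) (hlam0.trans hlam.le))
  have hmain : 0 ≤ √X.rank * √(2 * lam) := by positivity
  have hone (n : ℕ) (h : 2 * (k / 2) + n = k) :
      tfrob (T ∘ threeBlocks d h - (Q ⊗ₖ (Q ⊗ₖ (1 : Matrix (Fin n → Fin d) (Fin n → Fin d) ℝ))) *ᵥ
        (T ∘ threeBlocks d h)) ≤ 2 * (√X.rank * √(2 * lam)) := by
    have := tfrob_sub_kronecker_mulVec_le hQh hQ.2.1 (1 : Matrix (Fin n → Fin d) _ ℝ)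
      (S := T ∘ threeBlocks d h) fun x y z => hsym.threeBlocks_swap_first_second h x y z
    rw [tfrob_threeBlocks_sub_first_factor, one_kronecker_one, one_kronecker_one, one_mulVec,
      sub_self] at this
    have h0 : tfrob
        (0 : (Fin (k / 2) → Fin d) × (Fin (k / 2) → Fin d) × (Fin n → Fin d) → ℝ) = 0 := by
      simp [tfrob]
    linarith
  refine ⟨fun hk3 => ?_, fun hke => ?_, fun hko => ?_⟩
  · have h : 2 * (k / 2) + k / 2 = k := by omega
    rw [tfrob_sub_sum_seg_eq T h Q Q]
    have := tfrob_sub_kronecker_mulVec_le hQh hQ.2.1 Q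
      (S := T ∘ threeBlocks d h) fun x y z => hsym.threeBlocks_swap_first_second h x y z
    rw [tfrob_sub_third_factor_eq Q (S := T ∘ threeBlocks d h)
        fun x y z => hsym.threeBlocks_swap_first_third h x y z,
      tfrob_threeBlocks_sub_first_factor] at this
    linarith
  · have h : 2 * (k / 2) + 0 = k := by omega
    have heq := tfrob_sub_sum_seg_eq T h Q 1
    simp only [one_apply, eq_iff_true_of_subsingleton, if_true, mul_one] at heq
    rw [heq]
    have := hone 0 h
    linarith
  · have h : 2 * (k / 2) + (k - 2 * (k / 2)) = k := by omega
    have heq := tfrob_sub_sum_seg_eq T h Q 1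
    simp only [one_apply] at heq
    rw [heq]
    have := hone _ h
    linarith
end

section
/- Let $x$ be a random vector in $\mathbb{R}^d$ satisfying the subgaussian condition $\mathbb{E}[\exp\langle x,v\rangle]\le\exp\{\tau^2\|v\|^2/(2d)\}$ for all $v\in\mathbb{R}^d$. Then for all $0\le\psi<d$, $\mathbb{E}\exp\big\{\frac{\psi\|x\|^2}{2\tau^2}\big\} \le (1-\psi/d)^{-d/2}$, and for all $0\le\psi\le d/2$, $(1-\psi/d)^{-d/2} \le \exp\big\{\frac{\psi(1+\psi/d)}{2}\big\}$. -/
open MeasureTheory ProbabilityTheory Real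
open scoped RealInnerProductSpace

/-- The real Gaussian integral with a linear term, as a lower Lebesgue integral. -/
lemma lintegral_rexp_neg_mul_sq_norm_add {V : Type*} [NormedAddCommGroup V]
    [InnerProductSpace ℝ V] [FiniteDimensional ℝ V] [MeasurableSpace V] [BorelSpace V]
    {c : ℝ} (hc : 0 < c) (w : V) :
    ∫⁻ v : V, ENNReal.ofReal (Real.exp (-c * ‖v‖ ^ 2 + ⟪w, v⟫)) =
      ENNReal.ofReal ((π / c) ^ (Module.finrank ℝ V / 2 : ℝ) * Real.exp (‖w‖ ^ 2 / (4 * c))) := by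
  have hcast (v : V) : Complex.exp (-(c : ℂ) * ‖v‖ ^ 2 + 1 * ⟪w, v⟫) =
      (Real.exp (-c * ‖v‖ ^ 2 + ⟪w, v⟫) : ℂ) := by
    push_cast; simp
  have hc' : 0 < (c : ℂ).re := hc
  have hint := GaussianFourier.integrable_cexp_neg_mul_sq_norm_add hc' 1 w
  have hval := GaussianFourier.integral_cexp_neg_mul_sq_norm_add hc' 1 w
  simp_rw [hcast] at hint hval
  have hint' : Integrable fun v : V ↦ Real.exp (-c * ‖v‖ ^ 2 + ⟪w, v⟫) := by
    simpa only [RCLike.re_eq_complex_re, Complex.ofReal_re] using hint.re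
  rw [← ofReal_integral_eq_lintegral_ofReal hint' (.of_forall fun v ↦ (Real.exp_pos _).le)]
  congr 1
  rw [integral_complex_ofReal] at hval
  rw [← Complex.ofReal_inj, hval, Complex.ofReal_mul, Complex.ofReal_cpow (by positivity)]
  push_cast
  simp

/-- A random vector that is subgaussian with variance proxy `σ` has the exponential moments of the
squared norm bounded by those of a centered Gaussian vector with covariance `σ • 1`. -/
lemma lintegral_exp_sq_norm_le_of_subgaussian {V : Type*} [NormedAddCommGroup V]
    [InnerProductSpace ℝ V] [FiniteDimensional ℝ V] [MeasurableSpace V] [BorelSpace V]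
    {Ω : Type*} [MeasurableSpace Ω] {μ : Measure Ω} [SFinite μ] {x : Ω → V} (hx : Measurable x)
    {σ c : ℝ} (hc : 0 < c) (hσ : σ / 2 < c)
    (hsub : ∀ v : V, ∫⁻ ω, ENNReal.ofReal (Real.exp ⟪x ω, v⟫) ∂μ ≤
      ENNReal.ofReal (Real.exp (σ * ‖v‖ ^ 2 / 2))) :
    ∫⁻ ω, ENNReal.ofReal (Real.exp (‖x ω‖ ^ 2 / (4 * c))) ∂μ ≤
      ENNReal.ofReal ((c / (c - σ / 2)) ^ (Module.finrank ℝ V / 2 : ℝ)) := by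
  have hb : 0 < c - σ / 2 := sub_pos.2 hσ
  set r : ℝ := Module.finrank ℝ V / 2 with hr
  have hpos : 0 < (π / c) ^ r := by positivity
  have htonelli : ENNReal.ofReal ((π / c) ^ r) *
      ∫⁻ ω, ENNReal.ofReal (Real.exp (‖x ω‖ ^ 2 / (4 * c))) ∂μ ≤
      ENNReal.ofReal ((π / (c - σ / 2)) ^ r) := by
    calc
      _ = ∫⁻ ω, (∫⁻ v : V, ENNReal.ofReal (Real.exp (-c * ‖v‖ ^ 2 + ⟪x ω, v⟫))) ∂μ := by
        simp_rw [lintegral_rexp_neg_mul_sq_norm_add hc, ← hr, ENNReal.ofReal_mul hpos.le]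
        rw [lintegral_const_mul _ (by fun_prop)]
      _ = ∫⁻ v : V, ∫⁻ ω, ENNReal.ofReal (Real.exp (-c * ‖v‖ ^ 2 + ⟪x ω, v⟫)) ∂μ := by
        refine lintegral_lintegral_swap (Measurable.aemeasurable ?_)
        unfold Function.uncurry
        fun_prop
      _ ≤ ∫⁻ v : V, ENNReal.ofReal (Real.exp (-(c - σ / 2) * ‖v‖ ^ 2 + ⟪(0 : V), v⟫)) := by
        refine lintegral_mono fun v ↦ ?_
        simp_rw [Real.exp_add, ENNReal.ofReal_mul (Real.exp_pos _).le]
        rw [lintegral_const_mul _ (by fun_prop)]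
        refine (mul_le_mul_right (hsub v) _).trans_eq ?_
        rw [← ENNReal.ofReal_mul (Real.exp_pos _).le, ← ENNReal.ofReal_mul (Real.exp_pos _).le,
          ← Real.exp_add, ← Real.exp_add, inner_zero_left]
        ring_nf
      _ = _ := by
        rw [lintegral_rexp_neg_mul_sq_norm_add hb]
        simp [r]
  have hsplit : (π / (c - σ / 2)) ^ r = (π / c) ^ r * (c / (c - σ / 2)) ^ r := by
    rw [← Real.mul_rpow (by positivity) (by positivity), div_mul_div_cancel₀ hc.ne']
  rw [hsplit, ENNReal.ofReal_mul hpos.le] at htonelli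
  exact (ENNReal.mul_le_mul_iff_right (by simpa using hpos) ENNReal.ofReal_ne_top).1 htonelli

lemma neg_log_one_sub_le {t : ℝ} (ht0 : 0 ≤ t) (ht : t ≤ 1 / 2) :
    -Real.log (1 - t) ≤ t * (1 + t) := by
  have h := Real.abs_log_sub_add_sum_range_le (x := t) (by rw [abs_of_nonneg ht0]; linarith) 4
  rw [abs_of_nonneg ht0] at h
  have hrem : t ^ 5 / (1 - t) ≤ 2 * t ^ 5 := by
    rw [div_le_iff₀ (by linarith)]
    nlinarith [pow_nonneg ht0 5]
  have hsum := (neg_le_abs _).trans (h.trans hrem)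
  norm_num [Finset.sum_range_succ] at hsum
  have hcube : t ^ 3 ≤ 1 / 8 := by
    calc t ^ 3 ≤ (1 / 2) ^ 3 := by gcongr
      _ = 1 / 8 := by norm_num
  have hpoly : 0 ≤ t ^ 2 * (1 / 2 - t / 3 - t ^ 2 / 4 - 2 * t ^ 3) :=
    mul_nonneg (by positivity) (by nlinarith)
  nlinarith [neg_abs_le (t + t ^ 2 / 2 + t ^ 3 / 3 + t ^ 4 / 4 + Real.log (1 - t))]

/-- If `x` is a random vector in `ℝ^d` which is `(τ²/d)`-subgaussian, i.e.
`𝔼 exp⟨x,v⟩ ≤ exp{τ²‖v‖²/(2d)}` for all `v`, then for `0 ≤ ψ < d` one has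
`𝔼 exp{ψ‖x‖²/(2τ²)} ≤ (1-ψ/d)^{-d/2}`, and for `0 ≤ ψ ≤ d/2` one has
`(1-ψ/d)^{-d/2} ≤ exp{ψ(1+ψ/d)/2}`. -/
theorem stmt16 {d : ℕ} (hd : 0 < d) {Ω : Type*} [MeasureSpace Ω]
    [IsProbabilityMeasure (ℙ : Measure Ω)] (τ : ℝ) (hτ : 0 < τ)
    (x : Ω → EuclideanSpace ℝ (Fin d)) (hx : Measurable x)
    (hsub : ∀ v : EuclideanSpace ℝ (Fin d),
      ∫⁻ ω, ENNReal.ofReal (Real.exp ⟪x ω, v⟫) ≤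
        ENNReal.ofReal (Real.exp (τ ^ 2 * ‖v‖ ^ 2 / (2 * d)))) :
    (∀ ψ : ℝ, 0 ≤ ψ → ψ < d →
      ∫⁻ ω, ENNReal.ofReal (Real.exp (ψ * ‖x ω‖ ^ 2 / (2 * τ ^ 2))) ≤
        ENNReal.ofReal ((1 - ψ / d) ^ (-(d : ℝ) / 2))) ∧
    (∀ ψ : ℝ, 0 ≤ ψ → ψ ≤ (d : ℝ) / 2 →
      (1 - ψ / d) ^ (-(d : ℝ) / 2) ≤ Real.exp (ψ * (1 + ψ / d) / 2)) := by
  have hd' : (0 : ℝ) < d := by exact_mod_cast hd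
  refine ⟨fun ψ hψ0 hψ ↦ ?_, fun ψ hψ0 hψ ↦ ?_⟩
  · rcases hψ0.eq_or_lt with rfl | hψ0
    · simp
    have hψd : ψ / d < 1 := (div_lt_one hd').2 hψ
    have hdiff : τ ^ 2 / (2 * ψ) - τ ^ 2 / d / 2 = τ ^ 2 / (2 * ψ) * (1 - ψ / d) := by
      field_simp
    have hc : 0 < τ ^ 2 / (2 * ψ) := by positivity
    have h := lintegral_exp_sq_norm_le_of_subgaussian (σ := τ ^ 2 / d) hx hc
      (sub_pos.1 (hdiff ▸ mul_pos hc (sub_pos.2 hψd)))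
      fun v ↦ (hsub v).trans_eq (by congr 2; field_simp)
    rw [hdiff, div_mul_cancel_left₀ hc.ne', finrank_euclideanSpace_fin,
      Real.inv_rpow (sub_pos.2 hψd).le, ← Real.rpow_neg (sub_pos.2 hψd).le, ← neg_div] at h
    convert h using 5 with ω
    field_simp
    norm_num
  · have ht : ψ / d ≤ 1 / 2 := by
      rw [div_le_iff₀ hd']
      linarith
    rw [Real.rpow_def_of_pos (by linarith), Real.exp_le_exp]
    calc Real.log (1 - ψ / d) * (-(d : ℝ) / 2) = d / 2 * -Real.log (1 - ψ / d) := by ring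
      _ ≤ d / 2 * (ψ / d * (1 + ψ / d)) := by
        gcongr
        exact neg_log_one_sub_le (by positivity) ht
      _ = ψ * (1 + ψ / d) / 2 := by field_simp
end

section
/- Let $x$ be a random vector in $\mathbb{R}^d$ satisfying $\mathbb{E}[xx^{\mathsf{t}}] = I_d/d$ and the subgaussian condition $\mathbb{E}[\exp\langle x,v\rangle]\le\exp\{\tau^2\|v\|^2/(2d)\}$ for all $v\in\mathbb{R}^d$. Then: (i) there is an absolute constant $c$ such that for any $0\le\theta\le 1-1/\log d$, $\mathbb{P}(\|x\|^2\ge\theta) \ge \frac{1-\theta}{\tau^2} - \frac{c\log d}{d^{1/2}}$; and (ii) for any fixed $v\in\mathbb{R}^d$, $\mathbb{P}\big(d\langle x,v\rangle^2 \ge \|v\|^2/100\big) \ge \frac{1}{2\tau^2(8+3\log(\tau^2))}$. -/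
open MeasureTheory ProbabilityTheory Real
open scoped RealInnerProductSpace

section GaussianIntegral

variable {E : Type*} [NormedAddCommGroup E] [InnerProductSpace ℝ E] [FiniteDimensional ℝ E]
  [MeasurableSpace E] [BorelSpace E]

lemma lintegral_exp_neg_mul_sq_norm {b : ℝ} (hb : 0 < b) :
    ∫⁻ v : E, ENNReal.ofReal (exp (-b * ‖v‖ ^ 2)) =
      ENNReal.ofReal ((π / b) ^ (Module.finrank ℝ E / 2 : ℝ)) := by
  have h := GaussianFourier.integral_rexp_neg_mul_sq_norm (V := E) hb
  rw [← h, ofReal_integral_eq_lintegral_ofReal]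
  · by_contra hn
    rw [integral_undef hn] at h
    have : 0 < (π / b) ^ (Module.finrank ℝ E / 2 : ℝ) := by positivity
    linarith
  · exact .of_forall fun _ => (exp_pos _).le

/-- The Gaussian Laplace transform, by completing the square. -/
lemma lintegral_exp_inner_sub_mul_sq_norm {b : ℝ} (hb : 0 < b) (w : E) :
    ∫⁻ v : E, ENNReal.ofReal (exp (⟪w, v⟫ - b * ‖v‖ ^ 2)) =
      ENNReal.ofReal (exp (‖w‖ ^ 2 / (4 * b))) *
        ENNReal.ofReal ((π / b) ^ (Module.finrank ℝ E / 2 : ℝ)) := by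
  have key (v : E) : ENNReal.ofReal (exp (⟪w, v⟫ - b * ‖v‖ ^ 2)) =
      ENNReal.ofReal (exp (‖w‖ ^ 2 / (4 * b))) *
        ENNReal.ofReal (exp (-b * ‖v - (1 / (2 * b)) • w‖ ^ 2)) := by
    rw [← ENNReal.ofReal_mul (exp_pos _).le, ← exp_add, norm_sub_sq_real, inner_smul_right,
      norm_smul, Real.norm_eq_abs, mul_pow, sq_abs, real_inner_comm]
    congr 2
    field_simp
    ring
  simp_rw [key]
  rw [lintegral_const_mul' _ _ ENNReal.ofReal_ne_top,
    lintegral_sub_right_eq_self (fun v : E => ENNReal.ofReal (exp (-b * ‖v‖ ^ 2))),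
    lintegral_exp_neg_mul_sq_norm hb]

/-- A subgaussian random vector has the exponential square moments of a Gaussian one. -/
lemma lintegral_exp_sq_norm_le {Ω : Type*} [MeasurableSpace Ω] {μ : Measure Ω} [SFinite μ]
    {X : Ω → E} (hX : Measurable X) {V s : ℝ} (hV : 0 < V) (hs : 0 < s) (hs1 : s < 1)
    (h : ∀ v : E, ∫⁻ ω, ENNReal.ofReal (exp ⟪X ω, v⟫) ∂μ ≤
      ENNReal.ofReal (exp (V * ‖v‖ ^ 2 / 2))) :
    ∫⁻ ω, ENNReal.ofReal (exp (s / (2 * V) * ‖X ω‖ ^ 2)) ∂μ ≤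
      ENNReal.ofReal ((1 - s) ^ (-(Module.finrank ℝ E / 2 : ℝ))) := by
  set n : ℝ := Module.finrank ℝ E / 2
  set b : ℝ := V / (2 * s) with hb_def
  have hs1' : 0 < 1 - s := by linarith
  have hb : 0 < b := by positivity
  have hb1 : 0 < b * (1 - s) := by positivity
  have hK : 0 < (π / b) ^ n := by positivity
  have hbs : b * s = V / 2 := by rw [hb_def]; field_simp
  have hmul : (∫⁻ ω, ENNReal.ofReal (exp (s / (2 * V) * ‖X ω‖ ^ 2)) ∂μ) *
      ENNReal.ofReal ((π / b) ^ n) ≤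
      ENNReal.ofReal ((1 - s) ^ (-n)) * ENNReal.ofReal ((π / b) ^ n) := by
    calc _ = ∫⁻ ω, (∫⁻ v : E, ENNReal.ofReal (exp (⟪X ω, v⟫ - b * ‖v‖ ^ 2))) ∂μ := by
          rw [← lintegral_mul_const' _ _ ENNReal.ofReal_ne_top]
          refine lintegral_congr fun ω => ?_
          rw [lintegral_exp_inner_sub_mul_sq_norm hb]
          congr 3
          rw [hb_def]
          field_simp
          ring
      _ = ∫⁻ v : E, ∫⁻ ω, ENNReal.ofReal (exp (⟪X ω, v⟫ - b * ‖v‖ ^ 2)) ∂μ := by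
          refine lintegral_lintegral_swap (Measurable.aemeasurable ?_)
          simp only [Function.uncurry_def]
          fun_prop
      _ ≤ ∫⁻ v : E, ENNReal.ofReal (exp (-(b * (1 - s)) * ‖v‖ ^ 2)) := by
          refine lintegral_mono fun v => ?_
          simp_rw [sub_eq_add_neg, exp_add, ENNReal.ofReal_mul (exp_pos _).le]
          rw [lintegral_mul_const' _ _ ENNReal.ofReal_ne_top]
          refine (mul_le_mul_left (h v) _).trans_eq ?_
          rw [← ENNReal.ofReal_mul (exp_pos _).le, ← exp_add]
          congr 2
          linear_combination (-‖v‖ ^ 2) * hbs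
      _ = _ := by
          rw [lintegral_exp_neg_mul_sq_norm hb1, ← ENNReal.ofReal_mul (by positivity)]
          congr 1
          rw [← div_div, div_rpow (by positivity) hs1'.le, rpow_neg hs1'.le, div_eq_inv_mul]
  exact (ENNReal.mul_le_mul_iff_left (by positivity) ENNReal.ofReal_ne_top).1 hmul

end GaussianIntegral

section Truncation

variable {Ω : Type*} [MeasurableSpace Ω] {μ : Measure Ω}

lemma integrable_exp_of_lintegral_le {f : Ω → ℝ} (hf : Measurable f) {B : ℝ}
    (h : ∫⁻ ω, ENNReal.ofReal (exp (f ω)) ∂μ ≤ ENNReal.ofReal B) :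
    Integrable (fun ω => exp (f ω)) μ :=
  (lintegral_ofReal_ne_top_iff_integrable (by fun_prop)
    (.of_forall fun _ => (exp_pos _).le)).1 (h.trans_lt ENNReal.ofReal_lt_top).ne

lemma integral_exp_le_of_lintegral_le {f : Ω → ℝ} (hf : Measurable f) {B : ℝ} (hB : 0 ≤ B)
    (h : ∫⁻ ω, ENNReal.ofReal (exp (f ω)) ∂μ ≤ ENNReal.ofReal B) :
    ∫ ω, exp (f ω) ∂μ ≤ B := by
  rw [← ENNReal.ofReal_le_ofReal_iff hB, ofReal_integral_eq_lintegral_ofReal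
    (integrable_exp_of_lintegral_le hf h) (.of_forall fun _ => (exp_pos _).le)]
  exact h

variable [IsProbabilityMeasure μ]

/-- Bounding a mean by truncating the variable at height `M`. -/
lemma integral_le_add_mul_measureReal {Z : Ω → ℝ} (hZ : Measurable Z) (hint : Integrable Z μ)
    {l M θ B : ℝ} (hl : 0 < l) (hθ : 0 ≤ θ) (hB : 0 ≤ B)
    (h : ∫⁻ ω, ENNReal.ofReal (exp (l * Z ω)) ∂μ ≤ ENNReal.ofReal B) :
    ∫ ω, Z ω ∂μ ≤ θ + M * μ.real {ω | θ ≤ Z ω} + exp (-(l * M)) * B / l := by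
  have hlZ : Measurable fun ω => l * Z ω := by fun_prop
  have hS : MeasurableSet {ω | θ ≤ Z ω} := measurableSet_le measurable_const hZ
  have hi1 : Integrable (Set.indicator {ω | θ ≤ Z ω} fun _ => M) μ :=
    (integrable_const M).indicator hS
  have hi2 : Integrable (fun ω => exp (-(l * M)) / l * exp (l * Z ω)) μ :=
    (integrable_exp_of_lintegral_le hlZ h).const_mul _
  calc ∫ ω, Z ω ∂μ
      ≤ ∫ ω, (θ + Set.indicator {ω | θ ≤ Z ω} (fun _ => M) ω +
          exp (-(l * M)) / l * exp (l * Z ω)) ∂μ := by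
        refine integral_mono hint (((integrable_const θ).add hi1).add hi2) fun ω => ?_
        have hpos : 0 ≤ exp (-(l * M)) / l * exp (l * Z ω) := by positivity
        by_cases hω : θ ≤ Z ω
        · have he : l * (Z ω - M) ≤ exp (-(l * M)) * exp (l * Z ω) := by
            rw [← exp_add]
            have := add_one_le_exp (-(l * M) + l * Z ω)
            linarith
          have hd : Z ω - M ≤ exp (-(l * M)) / l * exp (l * Z ω) := by
            rw [div_mul_eq_mul_div, le_div_iff₀ hl]
            linarith
          simp only [Set.indicator, Set.mem_ofPred_eq, hω, if_true]
          linarith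
        · simp only [Set.indicator, Set.mem_ofPred_eq, hω, if_false]
          push Not at hω
          linarith
    _ = θ + M * μ.real {ω | θ ≤ Z ω} + exp (-(l * M)) / l * ∫ ω, exp (l * Z ω) ∂μ := by
        rw [integral_add (by exact (integrable_const θ).add hi1) hi2,
          integral_add (integrable_const θ) hi1, integral_indicator hS, integral_const_mul]
        simp [mul_comm M]
    _ ≤ _ := by
        have := integral_exp_le_of_lintegral_le hlZ hB h
        have h0 : 0 ≤ exp (-(l * M)) / l := by positivity
        rw [mul_div_right_comm]
        gcongr

end Truncation

section RealSubgaussian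

variable {Ω : Type*} [MeasurableSpace Ω] {μ : Measure Ω} [IsProbabilityMeasure μ]

/-- The variance proxy of a subgaussian variable is at least its second moment. -/
lemma one_le_of_subgaussian {Y : Ω → ℝ} (hY : Measurable Y)
    (hint : Integrable (fun ω => Y ω ^ 2) μ) (h1 : ∫ ω, Y ω ^ 2 ∂μ = 1) {V : ℝ} (hV : 0 < V)
    (h : ∀ v : ℝ, ∫⁻ ω, ENNReal.ofReal (exp ⟪Y ω, v⟫) ∂μ ≤
      ENNReal.ofReal (exp (V * ‖v‖ ^ 2 / 2))) : 1 ≤ V := by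
  by_contra! hlt
  set l : ℝ := (1 - V) / 4 with hl_def
  have hl : 0 < l := by rw [hl_def]; linarith
  have hs : 0 < 2 * V * l := by positivity
  have hs1 : 0 < 1 - 2 * V * l := by rw [hl_def]; nlinarith
  have hA := lintegral_exp_sq_norm_le hY hV hs (by linarith) h
  have hrw : 2 * V * l / (2 * V) = l := by field_simp
  simp only [hrw, norm_eq_abs, sq_abs, Module.finrank_self, Nat.cast_one] at hA
  have hm : Measurable fun ω => l * Y ω ^ 2 := by fun_prop
  have hB := integral_exp_le_of_lintegral_le hm (by positivity) hA
  have hC : 1 + l ≤ ∫ ω, exp (l * Y ω ^ 2) ∂μ := by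
    calc 1 + l = ∫ ω, (1 + l * Y ω ^ 2) ∂μ := by
          rw [integral_add (integrable_const _) (hint.const_mul l), integral_const_mul, h1]
          simp
      _ ≤ _ := integral_mono ((integrable_const _).add (hint.const_mul l))
          (integrable_exp_of_lintegral_le hm hA) fun ω => by
            have := add_one_le_exp (l * Y ω ^ 2)
            simp only
            linarith
  have hD : 1 + l ≤ (1 - 2 * V * l) ^ (-(1 / 2 : ℝ)) := hC.trans hB
  have hE : (1 + l) ^ 2 ≤ (1 - 2 * V * l)⁻¹ := by
    calc (1 + l) ^ 2 ≤ ((1 - 2 * V * l) ^ (-(1 / 2 : ℝ))) ^ 2 := by gcongr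
      _ = _ := by
        rw [← rpow_natCast, ← rpow_mul hs1.le, ← rpow_neg_one]
        norm_num
  rw [le_inv_comm₀ (by positivity) hs1, ← one_div, le_div_iff₀ (by positivity)] at hE
  have : (1 - 2 * V * l) * (1 + 2 * l) ≤ 1 := by nlinarith
  have h2 : l * (1 - V - 2 * V * l) ≤ 0 := by linarith
  have h3 : 1 - V - 2 * V * l ≤ 0 := by
    by_contra! h'
    linarith [mul_pos hl h']
  rw [hl_def] at h3
  nlinarith

lemma smallBall_of_subgaussian {Y : Ω → ℝ} (hY : Measurable Y)
    (hint : Integrable (fun ω => Y ω ^ 2) μ) (h1 : ∫ ω, Y ω ^ 2 ∂μ = 1) {V : ℝ} (hV : 1 ≤ V)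
    (h : ∀ v : ℝ, ∫⁻ ω, ENNReal.ofReal (exp ⟪Y ω, v⟫) ∂μ ≤
      ENNReal.ofReal (exp (V * ‖v‖ ^ 2 / 2))) :
    1 / (2 * V * (8 + 3 * log V)) ≤ μ.real {ω | 1 / 100 ≤ Y ω ^ 2} := by
  have hV0 : 0 < V := by linarith
  have hL : 0 ≤ log V := log_nonneg hV
  have hA := lintegral_exp_sq_norm_le (s := 3 / 4) hY hV0 (by norm_num) (by norm_num) h
  simp only [norm_eq_abs, sq_abs, Module.finrank_self, Nat.cast_one] at hA
  have h2 : (1 - 3 / 4 : ℝ) ^ (-(1 / 2 : ℝ)) = 2 := by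
    rw [show (1 - 3 / 4 : ℝ) = (2 : ℝ) ^ (-2 : ℝ) by
      rw [rpow_neg (by norm_num)]; norm_num, ← rpow_mul (by norm_num)]
    norm_num
  rw [h2] at hA
  set l : ℝ := 3 / 4 / (2 * V) with hl_def
  have hl : 0 < l := by positivity
  set M : ℝ := (3 + log V) / l with hM_def
  have hT := integral_le_add_mul_measureReal (Z := fun ω => Y ω ^ 2) (θ := 1 / 100) (M := M)
    (by fun_prop) hint hl (by norm_num) (by norm_num) hA
  have hlM : l * M = 3 + log V := by rw [hM_def]; field_simp
  rw [h1, hlM] at hT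
  have hexp : exp (-(3 + log V)) * 2 / l ≤ 4 / 15 := by
    rw [neg_add, exp_add, exp_neg (log V), exp_log hV0, hl_def, exp_neg]
    have h3 : (20 : ℝ) ≤ exp 3 := by
      have := exp_one_gt_d9
      have h' : exp 3 = exp 1 ^ 3 := by rw [← exp_nat_mul]; norm_num
      rw [h']
      calc (20 : ℝ) ≤ 2.718 ^ 3 := by norm_num
        _ ≤ _ := by gcongr; linarith
    have h4 : (exp 3)⁻¹ ≤ 1 / 20 := by
      rw [← one_div]; gcongr
    calc (exp 3)⁻¹ * V⁻¹ * 2 / (3 / 4 / (2 * V)) = 16 / 3 * (exp 3)⁻¹ := by field_simp; norm_num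
      _ ≤ _ := by linarith
  set p := μ.real {ω | 1 / 100 ≤ Y ω ^ 2}
  have hMp : 18 / 25 ≤ M * p := by linarith
  have hM : M = 8 / 3 * V * (3 + log V) := by rw [hM_def, hl_def]; field_simp; ring
  rw [div_le_iff₀ (by positivity)]
  have hp : 0 ≤ p := measureReal_nonneg
  rw [hM] at hMp
  nlinarith [mul_nonneg (mul_nonneg hp hV0.le) hL, mul_nonneg hp hV0.le]

end RealSubgaussian

lemma exp_neg_le_one_sub {s : ℝ} (hs : 0 ≤ s) (hs1 : s ≤ 1 / 2) :
    exp (-(s * (1 + s))) ≤ 1 - s := by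
  have h := quadratic_le_exp_of_nonneg (x := s * (1 + s)) (by positivity)
  rw [exp_neg, inv_le_comm₀ (exp_pos _) (by linarith), ← one_div,
    div_le_iff₀ (by linarith)]
  refine le_trans ?_ (mul_le_mul_of_nonneg_right h (by linarith))
  have h0 : 0 ≤ 1 - s - s ^ 2 - s ^ 3 := by nlinarith [pow_nonneg hs 2]
  nlinarith [mul_nonneg (pow_nonneg hs 2) h0]

section Isotropic

variable {Ω : Type*} [MeasurableSpace Ω] {μ : Measure Ω}
  {d : ℕ} {x : Ω → EuclideanSpace ℝ (Fin d)}

lemma memLp_coord_of_isotropic (hd : d ≠ 0) (hx : Measurable x)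
    (hcov : ∀ i j : Fin d, ∫ ω, x ω i * x ω j ∂μ = if i = j then 1 / (d : ℝ) else 0)
    (i : Fin d) : MemLp (fun ω => x ω i) 2 μ := by
  rw [memLp_two_iff_integrable_sq (Measurable.aestronglyMeasurable (by fun_prop))]
  refine Integrable.of_integral_ne_zero ?_
  simp_rw [pow_two, hcov i i]
  simpa using hd

lemma integrable_inner_sq_of_isotropic (hd : d ≠ 0) (hx : Measurable x)
    (hcov : ∀ i j : Fin d, ∫ ω, x ω i * x ω j ∂μ = if i = j then 1 / (d : ℝ) else 0)
    (v : EuclideanSpace ℝ (Fin d)) :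
    Integrable (fun ω => ⟪x ω, v⟫ ^ 2) μ := by
  have : MemLp (fun ω => ⟪x ω, v⟫) 2 μ := by
    simp only [PiLp.inner_apply, RCLike.inner_apply, conj_trivial]
    exact memLp_finsetSum _ fun i _ => (memLp_coord_of_isotropic hd hx hcov i).const_mul (v i)
  exact this.integrable_sq

lemma integral_inner_sq_of_isotropic (hd : d ≠ 0) (hx : Measurable x)
    (hcov : ∀ i j : Fin d, ∫ ω, x ω i * x ω j ∂μ = if i = j then 1 / (d : ℝ) else 0)
    (v : EuclideanSpace ℝ (Fin d)) :
    ∫ ω, ⟪x ω, v⟫ ^ 2 ∂μ = ‖v‖ ^ 2 / d := by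
  have hi (i j : Fin d) : Integrable (fun ω => v i * v j * (x ω i * x ω j)) μ :=
    ((memLp_coord_of_isotropic hd hx hcov i).integrable_mul
      (memLp_coord_of_isotropic hd hx hcov j)).const_mul _
  have hexp (ω : Ω) : ⟪x ω, v⟫ ^ 2 = ∑ i, ∑ j, v i * v j * (x ω i * x ω j) := by
    simp only [PiLp.inner_apply, RCLike.inner_apply, conj_trivial, pow_two, Finset.sum_mul_sum]
    exact Finset.sum_congr rfl fun i _ => Finset.sum_congr rfl fun j _ => by ring
  simp_rw [hexp]
  rw [integral_finsetSum _ fun i _ => integrable_finsetSum _ fun j _ => hi i j]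
  simp_rw [fun i => integral_finsetSum Finset.univ fun j _ => hi i j, integral_const_mul, hcov]
  rw [EuclideanSpace.real_norm_sq_eq, Finset.sum_div]
  simp [pow_two, div_eq_mul_inv]

lemma integrable_norm_sq_of_isotropic (hd : d ≠ 0) (hx : Measurable x)
    (hcov : ∀ i j : Fin d, ∫ ω, x ω i * x ω j ∂μ = if i = j then 1 / (d : ℝ) else 0) :
    Integrable (fun ω => ‖x ω‖ ^ 2) μ := by
  simp_rw [EuclideanSpace.real_norm_sq_eq]
  exact integrable_finsetSum _ fun i _ => (memLp_coord_of_isotropic hd hx hcov i).integrable_sq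

lemma integral_norm_sq_of_isotropic (hd : d ≠ 0) (hx : Measurable x)
    (hcov : ∀ i j : Fin d, ∫ ω, x ω i * x ω j ∂μ = if i = j then 1 / (d : ℝ) else 0) :
    ∫ ω, ‖x ω‖ ^ 2 ∂μ = 1 := by
  simp_rw [EuclideanSpace.real_norm_sq_eq]
  rw [integral_finsetSum _ fun i _ => (memLp_coord_of_isotropic hd hx hcov i).integrable_sq]
  simp_rw [pow_two, hcov]
  simp [hd]

/-- The rescaled marginal of a subgaussian vector along `v` is a subgaussian variable. -/
lemma lintegral_exp_marginal_le (hd : d ≠ 0) {τ : ℝ}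
    (h : ∀ v : EuclideanSpace ℝ (Fin d), ∫⁻ ω, ENNReal.ofReal (exp ⟪x ω, v⟫) ∂μ ≤
      ENNReal.ofReal (exp (τ ^ 2 * ‖v‖ ^ 2 / (2 * d))))
    {v : EuclideanSpace ℝ (Fin d)} (hv : v ≠ 0) (r : ℝ) :
    ∫⁻ ω, ENNReal.ofReal (exp ⟪√d / ‖v‖ * ⟪x ω, v⟫, r⟫) ∂μ ≤
      ENNReal.ofReal (exp (τ ^ 2 * ‖r‖ ^ 2 / 2)) := by
  have hv' : ‖v‖ ≠ 0 := norm_ne_zero_iff.2 hv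
  have hd' : (d : ℝ) ≠ 0 := by exact_mod_cast hd
  refine (lintegral_congr fun ω => ?_).trans_le ((h ((√d / ‖v‖ * r) • v)).trans_eq ?_)
  · rw [inner_smul_right, RCLike.inner_apply, conj_trivial]
    ring_nf
  · rw [norm_smul, norm_eq_abs, norm_eq_abs, mul_pow, sq_abs, sq_abs, mul_pow, div_pow,
      sq_sqrt (Nat.cast_nonneg d)]
    congr 2
    field_simp

lemma sq_marginal {Ω : Type*} {d : ℕ} {x : Ω → EuclideanSpace ℝ (Fin d)}
    (v : EuclideanSpace ℝ (Fin d)) (ω : Ω) :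
    (√d / ‖v‖ * ⟪x ω, v⟫) ^ 2 = d / ‖v‖ ^ 2 * ⟪x ω, v⟫ ^ 2 := by
  rw [mul_pow, div_pow, sq_sqrt (Nat.cast_nonneg d)]

lemma integrable_sq_marginal (hd : d ≠ 0) (hx : Measurable x)
    (hcov : ∀ i j : Fin d, ∫ ω, x ω i * x ω j ∂μ = if i = j then 1 / (d : ℝ) else 0)
    (v : EuclideanSpace ℝ (Fin d)) :
    Integrable (fun ω => (√d / ‖v‖ * ⟪x ω, v⟫) ^ 2) μ := by
  simp_rw [sq_marginal]
  exact (integrable_inner_sq_of_isotropic hd hx hcov v).const_mul _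

lemma integral_sq_marginal (hd : d ≠ 0) (hx : Measurable x)
    (hcov : ∀ i j : Fin d, ∫ ω, x ω i * x ω j ∂μ = if i = j then 1 / (d : ℝ) else 0)
    {v : EuclideanSpace ℝ (Fin d)} (hv : v ≠ 0) :
    ∫ ω, (√d / ‖v‖ * ⟪x ω, v⟫) ^ 2 ∂μ = 1 := by
  have hv' : ‖v‖ ≠ 0 := norm_ne_zero_iff.2 hv
  have hd' : (d : ℝ) ≠ 0 := by exact_mod_cast hd
  simp_rw [sq_marginal]
  rw [integral_const_mul, integral_inner_sq_of_isotropic hd hx hcov]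
  field_simp

variable [IsProbabilityMeasure μ]

lemma one_le_sq_of_isotropic (hd : d ≠ 0) (hx : Measurable x)
    (hcov : ∀ i j : Fin d, ∫ ω, x ω i * x ω j ∂μ = if i = j then 1 / (d : ℝ) else 0)
    {τ : ℝ} (hτ : 0 < τ)
    (h : ∀ v : EuclideanSpace ℝ (Fin d), ∫⁻ ω, ENNReal.ofReal (exp ⟪x ω, v⟫) ∂μ ≤
      ENNReal.ofReal (exp (τ ^ 2 * ‖v‖ ^ 2 / (2 * d)))) : 1 ≤ τ ^ 2 := by
  have : NeZero d := ⟨hd⟩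
  obtain ⟨v, hv⟩ := exists_ne (0 : EuclideanSpace ℝ (Fin d))
  exact one_le_of_subgaussian (by fun_prop) (integrable_sq_marginal hd hx hcov v)
    (integral_sq_marginal hd hx hcov hv) (by positivity) (lintegral_exp_marginal_le hd h hv)

lemma measureReal_norm_sq_ge (hd : d ≠ 0) (hx : Measurable x)
    (hcov : ∀ i j : Fin d, ∫ ω, x ω i * x ω j ∂μ = if i = j then 1 / (d : ℝ) else 0)
    {τ : ℝ} (hτ : 0 < τ)
    (h : ∀ v : EuclideanSpace ℝ (Fin d), ∫⁻ ω, ENNReal.ofReal (exp ⟪x ω, v⟫) ∂μ ≤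
      ENNReal.ofReal (exp (τ ^ 2 * ‖v‖ ^ 2 / (2 * d)))) {θ : ℝ} (hθ : 0 ≤ θ) :
    (1 - θ) / τ ^ 2 - 5 / √d ≤ μ.real {ω | θ ≤ ‖x ω‖ ^ 2} := by
  have hd1 : (1 : ℝ) ≤ d := by exact_mod_cast Nat.one_le_iff_ne_zero.2 hd
  have hd0 : (0 : ℝ) < d := by linarith
  have hτ1 := one_le_sq_of_isotropic hd hx hcov hτ h
  set T := τ ^ 2
  have hT0 : 0 < T := by linarith
  have hq : 1 ≤ √(d : ℝ) := one_le_sqrt.2 hd1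
  have hq2 : √(d : ℝ) ^ 2 = d := sq_sqrt hd0.le
  set q := √(d : ℝ)
  have hq0 : 0 < q := by linarith
  set s : ℝ := 1 / (2 * q) with hs_def
  have hs : 0 < s := by positivity
  have hs1 : s ≤ 1 / 2 := by
    rw [hs_def]
    gcongr
    linarith
  have hs1' : 0 < 1 - s := by linarith
  have hA := lintegral_exp_sq_norm_le (V := T / d) hx (by positivity) hs (by linarith)
    fun v => by
      convert h v using 3
      field_simp
  rw [finrank_euclideanSpace_fin] at hA
  set l : ℝ := s / (2 * (T / d)) with hl_def
  have hl : 0 < l := by positivity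
  have hTr := integral_le_add_mul_measureReal (Z := fun ω => ‖x ω‖ ^ 2) (M := T * (1 + s))
    (by fun_prop) (integrable_norm_sq_of_isotropic hd hx hcov) hl hθ
    (by positivity) hA
  rw [integral_norm_sq_of_isotropic hd hx hcov] at hTr
  set p := μ.real {ω | θ ≤ ‖x ω‖ ^ 2}
  have hB : exp (-(l * (T * (1 + s)))) * (1 - s) ^ (-(d / 2 : ℝ)) ≤ 1 := by
    have he : exp (-(l * (T * (1 + s)))) = exp (-(s * (1 + s))) ^ (d / 2 : ℝ) := by
      rw [← exp_mul, hl_def]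
      congr 1
      field_simp
    rw [he, rpow_neg hs1'.le, ← div_eq_mul_inv, div_le_one (by positivity)]
    exact rpow_le_rpow (exp_pos _).le (exp_neg_le_one_sub hs.le hs1) (by positivity)
  have htail : exp (-(l * (T * (1 + s)))) * (1 - s) ^ (-(d / 2 : ℝ)) / l ≤ 4 * T / q := by
    calc _ ≤ 1 / l := by gcongr
      _ = _ := by
        rw [hl_def, hs_def, ← hq2]
        field_simp
        norm_num
  have hmain : 1 - θ ≤ T * (1 + s) * p + 4 * T / q := by linarith
  have hp1 : p ≤ 1 := measureReal_le_one
  have hdiv : (1 - θ) / T ≤ (1 + s) * p + 4 / q := by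
    rw [div_le_iff₀ hT0]
    calc _ ≤ _ := hmain
      _ = _ := by ring
  have hsp : s * p ≤ 1 / q := by
    calc s * p ≤ s * 1 := by gcongr
      _ ≤ 1 / q := by
        rw [hs_def, mul_one]
        gcongr
        linarith
  have : 5 / q = 4 / q + 1 / q := by ring
  linarith

end Isotropic

/-- Lower tail bounds for an isotropic subgaussian random vector: there is an absolute
constant `c > 0` such that for any `d ≥ 2` and any random vector `x ∈ ℝ^d` with
`𝔼[xxᵀ] = I_d/d` and `𝔼 exp⟨x,v⟩ ≤ exp{τ²‖v‖²/(2d)}`: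
(i) for `0 ≤ θ ≤ 1 - 1/log d`, `ℙ(‖x‖² ≥ θ) ≥ (1-θ)/τ² - c·(log d)/√d`; and
(ii) for any fixed `v`, `ℙ(d⟨x,v⟩² ≥ ‖v‖²/100) ≥ 1/(2τ²(8 + 3 log τ²))`. -/
theorem stmt17 :
    ∃ c : ℝ, 0 < c ∧
      ∀ (d : ℕ), 2 ≤ d →
      ∀ (Ω : Type) (_ : MeasureSpace Ω), IsProbabilityMeasure (ℙ : Measure Ω) →
      ∀ (τ : ℝ), 0 < τ →
      ∀ (x : Ω → EuclideanSpace ℝ (Fin d)), Measurable x →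
      (∀ i j : Fin d, ∫ ω, x ω i * x ω j =
          if i = j then 1 / (d : ℝ) else 0) →
      (∀ v : EuclideanSpace ℝ (Fin d),
        ∫⁻ ω, ENNReal.ofReal (Real.exp ⟪x ω, v⟫) ≤
          ENNReal.ofReal (Real.exp (τ ^ 2 * ‖v‖ ^ 2 / (2 * d)))) →
      ((∀ θ : ℝ, 0 ≤ θ → θ ≤ 1 - 1 / Real.log d →
          ENNReal.ofReal ((1 - θ) / τ ^ 2 - c * Real.log d / Real.sqrt d) ≤
            ℙ {ω | θ ≤ ‖x ω‖ ^ 2}) ∧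
        (∀ v : EuclideanSpace ℝ (Fin d),
          ENNReal.ofReal (1 / (2 * τ ^ 2 * (8 + 3 * Real.log (τ ^ 2)))) ≤
            ℙ {ω | ‖v‖ ^ 2 / 100 ≤ (d : ℝ) * ⟪x ω, v⟫ ^ 2})) := by
  refine ⟨5, by norm_num, fun d hd Ω _ _ τ hτ x hx hcov h => ?_⟩
  have hd0 : d ≠ 0 := by omega
  have hτ1 := one_le_sq_of_isotropic hd0 hx hcov hτ h
  have hL : 0 ≤ log (τ ^ 2) := log_nonneg hτ1
  refine ⟨fun θ hθ hθ1 => ENNReal.ofReal_le_of_le_toReal ?_,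
    fun v => ENNReal.ofReal_le_of_le_toReal ?_⟩
  · refine le_trans ?_ (measureReal_norm_sq_ge hd0 hx hcov hτ h hθ)
    have hlog0 : 0 < log d := log_pos (by exact_mod_cast hd)
    have hlog : 1 ≤ log d := by
      have : 1 / log d ≤ 1 := by linarith
      rwa [div_le_one hlog0] at this
    gcongr
    linarith
  · rcases eq_or_ne v 0 with rfl | hv
    · simp only [norm_zero, inner_zero_right]
      have hone : (ℙ {_ω : Ω | (0 : ℝ) ^ 2 / 100 ≤ d * 0 ^ 2}).toReal = 1 := by simp
      rw [hone, div_le_one (by positivity)]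
      nlinarith
    · refine (smallBall_of_subgaussian (by fun_prop) (integrable_sq_marginal hd0 hx hcov v)
        (integral_sq_marginal hd0 hx hcov hv) hτ1
        (lintegral_exp_marginal_le hd0 h hv)).trans_eq ?_
      have hv' : 0 < ‖v‖ ^ 2 := by positivity
      rw [Measure.real]
      congr 2
      ext ω
      simp only [Set.mem_ofPred_eq, sq_marginal]
      rw [div_mul_eq_mul_div, le_div_iff₀ hv']
      ring_nf
end
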